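/- arXiv:1905.09145 — 2 statements merged into one kernel-verified Lean document; each statement's English description precedes it below -/
import Mathlib

section
/- Let d, m be positive integers, let A be a real m×d matrix, let v, v⁺ ∈ ℝ^d, σ, σ⁺ ∈ ℝ^m, τ_v, τ_σ ∈ ℝ, and set {{σ}} = (σ + σ⁺)/2. Then the sum of the face contributions from the two elements sharing an elastic-elastic interface, namely [ (Aᵀ{{σ}})·v + (τ_v/2)(A(v⁺ − v))·(Av) + (1/2)(A(v⁺ − v))·σ + (τ_σ/2)(Aᵀ(σ⁺ − σ))·(Aᵀσ) ] + [ ((−A)ᵀ{{σ}})·v⁺ + (τ_v/2)((−A)(v − v⁺))·((−A)v⁺) + (1/2)((−A)(v − v⁺))·σ⁺ + (τ_σ/2)((−A)ᵀ(σ − σ⁺))·((−A)ᵀσ⁺) ], equals −(τ_v/2)‖A(v⁺ − v)‖² − (τ_σ/2)‖Aᵀ(σ⁺ − σ)‖². In particular it is nonpositive when τ_v, τ_σ ≥ 0. -/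
open Matrix

/-- The sum of the face contributions from the two elements sharing an elastic-elastic
interface equals `-(τ_v/2)‖A⟦v⟧‖² - (τ_σ/2)‖Aᵀ⟦σ⟧‖²`; in particular it is nonpositive
when `τ_v, τ_σ ≥ 0`. -/
theorem elastic_interface_energy_contribution
    (d m : ℕ) (hd : 0 < d) (hm : 0 < m)
    (A : Matrix (Fin m) (Fin d) ℝ)
    (v vp : Fin d → ℝ) (σ σp : Fin m → ℝ) (τv τσ : ℝ) :
    ((Aᵀ.mulVec (((1 : ℝ)/2) • (σ + σp)) ⬝ᵥ v)
        + (τv/2) * (A.mulVec (vp - v) ⬝ᵥ A.mulVec v)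
        + ((1 : ℝ)/2) * (A.mulVec (vp - v) ⬝ᵥ σ)
        + (τσ/2) * (Aᵀ.mulVec (σp - σ) ⬝ᵥ Aᵀ.mulVec σ))
      + (((-A)ᵀ.mulVec (((1 : ℝ)/2) • (σ + σp)) ⬝ᵥ vp)
        + (τv/2) * ((-A).mulVec (v - vp) ⬝ᵥ (-A).mulVec vp)
        + ((1 : ℝ)/2) * ((-A).mulVec (v - vp) ⬝ᵥ σp)
        + (τσ/2) * ((-A)ᵀ.mulVec (σ - σp) ⬝ᵥ (-A)ᵀ.mulVec σp))
      = -(τv/2) * (A.mulVec (vp - v) ⬝ᵥ A.mulVec (vp - v))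
        - (τσ/2) * (Aᵀ.mulVec (σp - σ) ⬝ᵥ Aᵀ.mulVec (σp - σ)) ∧
    (0 ≤ τv → 0 ≤ τσ →
      ((Aᵀ.mulVec (((1 : ℝ)/2) • (σ + σp)) ⬝ᵥ v)
        + (τv/2) * (A.mulVec (vp - v) ⬝ᵥ A.mulVec v)
        + ((1 : ℝ)/2) * (A.mulVec (vp - v) ⬝ᵥ σ)
        + (τσ/2) * (Aᵀ.mulVec (σp - σ) ⬝ᵥ Aᵀ.mulVec σ))
      + (((-A)ᵀ.mulVec (((1 : ℝ)/2) • (σ + σp)) ⬝ᵥ vp)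
        + (τv/2) * ((-A).mulVec (v - vp) ⬝ᵥ (-A).mulVec vp)
        + ((1 : ℝ)/2) * ((-A).mulVec (v - vp) ⬝ᵥ σp)
        + (τσ/2) * ((-A)ᵀ.mulVec (σ - σp) ⬝ᵥ (-A)ᵀ.mulVec σp)) ≤ 0) := by
  have h : ∀ (s : Fin m → ℝ) (w : Fin d → ℝ), Aᵀ.mulVec s ⬝ᵥ w = A.mulVec w ⬝ᵥ s := by
    intro s w
    rw [mulVec_transpose, ← dotProduct_mulVec, dotProduct_comm]
  refine (fun {P Q : Prop} (x : P) (y : P → Q) => (⟨x, y x⟩ : P ∧ Q)) ?_ ?_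
  · have h1 := h σ v
    have h2 := h σ vp
    have h3 := h σp v
    have h4 := h σp vp
    have c1 := dotProduct_comm (A.mulVec v) (A.mulVec vp)
    have c2 := dotProduct_comm (Aᵀ.mulVec σ) (Aᵀ.mulVec σp)
    simp only [transpose_neg, neg_mulVec, mulVec_sub, mulVec_add, mulVec_smul, sub_dotProduct,
      dotProduct_sub, add_dotProduct, smul_dotProduct, neg_dotProduct, dotProduct_neg, smul_eq_mul,
      h1, h2, h3, h4, c1, c2]
    ring
  · intro e a b
    rw [e]
    have p : 0 ≤ A.mulVec (vp - v) ⬝ᵥ A.mulVec (vp - v) :=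
      Finset.sum_nonneg fun i _ => mul_self_nonneg _
    have q : 0 ≤ Aᵀ.mulVec (σp - σ) ⬝ᵥ Aᵀ.mulVec (σp - σ) :=
      Finset.sum_nonneg fun i _ => mul_self_nonneg _
    have := mul_nonneg a p
    have := mul_nonneg b q
    linarith
end

section
/- Let ρ₁, ρ₂ be nonzero reals and b₁ₚ, b₂ₚ, b₂ₛ, r ∈ ℝ. The determinant of the complex 3×3 matrix M with rows (0, 2i·b₂ₚ, −(2 − r²)), (r², (ρ₂/ρ₁)(2 − r²), 2i·(ρ₂/ρ₁)·b₂ₛ), (b₁ₚ, b₂ₚ, i) equals (ρ₂/ρ₁)·[((ρ₁/ρ₂)·b₂ₚ + b₁ₚ)·r⁴ − 4·b₁ₚ·r² − 4·b₁ₚ·(b₂ₚ·b₂ₛ − 1)]. Consequently, when ρ₁, ρ₂ > 0, det M = 0 if and only if ((ρ₁/ρ₂)·b₂ₚ + b₁ₚ)·r⁴ − 4·b₁ₚ·r² − 4·b₁ₚ·(b₂ₚ·b₂ₛ − 1) = 0. -/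
open Matrix Complex

theorem and_of_left_of_imp {p q : Prop} (hp : p) (h : p → q) : p ∧ q := ⟨hp, h hp⟩

/-- The determinant of the Scholte-wave amplitude system equals
`(ρ₂/ρ₁)·[((ρ₁/ρ₂)·b₂ₚ + b₁ₚ)·r⁴ − 4·b₁ₚ·r² − 4·b₁ₚ·(b₂ₚ·b₂ₛ − 1)]`; consequently, for
positive densities, it vanishes iff the quartic dispersion relation holds. -/
theorem scholte_dispersion_relation
    (ρ₁ ρ₂ b1p b2p b2s r : ℝ) (hρ₁ : ρ₁ ≠ 0) (hρ₂ : ρ₂ ≠ 0) :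
    (!![(0 : ℂ), 2 * Complex.I * (b2p : ℂ), -(2 - (r : ℂ)^2);
        (r : ℂ)^2, ((ρ₂/ρ₁ : ℝ) : ℂ) * (2 - (r : ℂ)^2), 2 * Complex.I * ((ρ₂/ρ₁ : ℝ) : ℂ) * (b2s : ℂ);
        (b1p : ℂ), (b2p : ℂ), Complex.I]).det
      = ((ρ₂/ρ₁ : ℝ) : ℂ) *
          ((((ρ₁/ρ₂) * b2p + b1p : ℝ) : ℂ) * (r : ℂ)^4
            - 4 * (b1p : ℂ) * (r : ℂ)^2
            - 4 * (b1p : ℂ) * ((b2p * b2s - 1 : ℝ) : ℂ)) ∧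
    (0 < ρ₁ → 0 < ρ₂ →
      ((!![(0 : ℂ), 2 * Complex.I * (b2p : ℂ), -(2 - (r : ℂ)^2);
          (r : ℂ)^2, ((ρ₂/ρ₁ : ℝ) : ℂ) * (2 - (r : ℂ)^2), 2 * Complex.I * ((ρ₂/ρ₁ : ℝ) : ℂ) * (b2s : ℂ);
          (b1p : ℂ), (b2p : ℂ), Complex.I]).det = 0 ↔
        ((ρ₁/ρ₂) * b2p + b1p) * r^4 - 4 * b1p * r^2 - 4 * b1p * (b2p * b2s - 1) = 0)) := by
  have h1 : (ρ₁ : ℂ) ≠ 0 := by exact_mod_cast hρ₁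
  have h2 : (ρ₂ : ℂ) ≠ 0 := by exact_mod_cast hρ₂
  have hq : ((ρ₂/ρ₁ : ℝ) : ℂ) * ((ρ₁/ρ₂ : ℝ) : ℂ) = 1 := by
    push_cast
    field_simp
  have hq0 : ((ρ₂/ρ₁ : ℝ) : ℂ) ≠ 0 := left_ne_zero_of_mul_eq_one hq
  refine and_of_left_of_imp ?_ (fun h _ _ => ?_)
  rotate_left
  · rw [h, mul_eq_zero, or_iff_right hq0]
    norm_cast
  · rw [Matrix.det_fin_three]
    simp only [Matrix.of_apply, Matrix.cons_val', Matrix.cons_val_zero, Matrix.cons_val_one,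
      Matrix.cons_val, Complex.ofReal_add, Complex.ofReal_sub, Complex.ofReal_mul,
      Complex.ofReal_one]
    generalize ((ρ₂/ρ₁ : ℝ) : ℂ) = q at *
    generalize ((ρ₁/ρ₂ : ℝ) : ℂ) = a at *
    have hI : Complex.I * Complex.I = -1 := Complex.I_mul_I
    linear_combination (-(b2p : ℂ) * r ^ 4) * hq +
      (-2 * (b2p : ℂ) * r ^ 2 + 4 * q * b2p * b2s * b1p) * hI
end
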